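/- Let b ∈ (−1,1) and set m_b = 2^{1+b}·Γ((1+b)/2)/Γ((1−b)/2). Let ψ : ℝ → ℝ be differentiable almost everywhere with ψ(y) = ψ(0) + ∫_0^y ψ'(t) dt for all y ∈ ℝ, and suppose ∫_ℝ |y|^b·(ψ'(y)² + ψ(y)²) dy < ∞. Then m_b·ψ(0)² ≤ ∫_ℝ |y|^b·(ψ'(y)² + ψ(y)²) dy, and equality holds for ψ = ψ_{(1−b)/2}; thus m_b is the sharp constant in this trace inequality. -/

import Mathlib

open MeasureTheory Real Filter Set

/-- The modified Bessel function of the second kind, for `y > 0` given by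
`K_s(y) = ∫_0^∞ e^{−y·cosh t}·cosh(s·t) dt`. -/
noncomputable def besselK (s y : ℝ) : ℝ :=
  ∫ t in Set.Ioi (0 : ℝ), Real.exp (-(y * Real.cosh t)) * Real.cosh (s * t)

/-- `ψ_s(y) = (2^{1−s}/Γ(s))·|y|^s·K_s(|y|)` for `y ≠ 0`, and `ψ_s(0) = 1`. -/
noncomputable def psi (s : ℝ) (y : ℝ) : ℝ :=
  if y = 0 then 1
  else (2 : ℝ) ^ (1 - s) / Real.Gamma s * |y| ^ s * besselK s |y|

/-- The Gamma-type integral `∫_0^∞ t^{s−1} e^{−t−y²/(4t)} dt`, equal to `2^{1−s} y^s K_s(y)` for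
`y > 0` and to `Γ(s)` at `y = 0`. -/
noncomputable def gammaBessel (s y : ℝ) : ℝ :=
  ∫ t in Ioi (0 : ℝ), rexp (-t - y ^ 2 / (4 * t)) * t ^ (s - 1)

lemma measurable_gammaBessel_integrand (s y : ℝ) :
    Measurable fun t : ℝ => rexp (-t - y ^ 2 / (4 * t)) * t ^ (s - 1) := by
  fun_prop

lemma gammaBessel_integrand_le (s y : ℝ) {t : ℝ} (ht : 0 < t) :
    ‖rexp (-t - y ^ 2 / (4 * t)) * t ^ (s - 1)‖ ≤ rexp (-t) * t ^ (s - 1) := by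
  rw [Real.norm_of_nonneg (by positivity)]
  gcongr
  have : 0 ≤ y ^ 2 / (4 * t) := by positivity
  linarith

lemma integrableOn_gammaBessel_integrand {s : ℝ} (hs : 0 < s) (y : ℝ) :
    IntegrableOn (fun t : ℝ => rexp (-t - y ^ 2 / (4 * t)) * t ^ (s - 1)) (Ioi 0) :=
  (GammaIntegral_convergent hs).mono' (measurable_gammaBessel_integrand s y).aestronglyMeasurable
    ((ae_restrict_mem measurableSet_Ioi).mono fun _ ht => gammaBessel_integrand_le s y ht)

lemma continuous_gammaBessel {s : ℝ} (hs : 0 < s) : Continuous (gammaBessel s) := by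
  refine continuous_of_dominated (bound := fun t => rexp (-t) * t ^ (s - 1))
    (fun y => (measurable_gammaBessel_integrand s y).aestronglyMeasurable)
    (fun y => (ae_restrict_mem measurableSet_Ioi).mono fun _ ht => gammaBessel_integrand_le s y ht)
    (GammaIntegral_convergent hs) (Eventually.of_forall fun t => ?_)
  fun_prop

lemma gammaBessel_zero {s : ℝ} (hs : 0 < s) : gammaBessel s 0 = Gamma s := by
  simp [gammaBessel, Gamma_eq_integral hs]

lemma gammaBessel_nonneg (s y : ℝ) : 0 ≤ gammaBessel s y :=
  setIntegral_nonneg measurableSet_Ioi fun t (ht : 0 < t) => by positivity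

lemma gammaBessel_le_Gamma {s : ℝ} (hs : 0 < s) (y : ℝ) : gammaBessel s y ≤ Gamma s := by
  rw [Gamma_eq_integral hs]
  exact setIntegral_mono_on (integrableOn_gammaBessel_integrand hs y)
    (GammaIntegral_convergent hs) measurableSet_Ioi fun t ht =>
      (le_norm_self _).trans (gammaBessel_integrand_le s y ht)

lemma exp_neg_le_inv {x : ℝ} (hx : 0 < x) : rexp (-x) ≤ x⁻¹ := by
  rw [Real.exp_neg]
  gcongr
  linarith [Real.add_one_le_exp x]

lemma gammaBessel_le_div_sq {s y : ℝ} (hs : 0 < s) (hy : 0 < y) :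
    gammaBessel s y ≤ 4 * Gamma (s + 1) / y ^ 2 := by
  have h1 : 0 < s + 1 := by linarith
  have : 4 * Gamma (s + 1) / y ^ 2
      = ∫ t in Ioi (0 : ℝ), 4 / y ^ 2 * (rexp (-t) * t ^ (s + 1 - 1)) := by
    rw [integral_const_mul, Gamma_eq_integral h1]; ring
  rw [this]
  refine setIntegral_mono_on (integrableOn_gammaBessel_integrand hs y)
    ((GammaIntegral_convergent h1).const_mul _) measurableSet_Ioi fun t (ht : 0 < t) => ?_
  have h2 := exp_neg_le_inv (x := y ^ 2 / (4 * t)) (by positivity)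
  have h3 : t ^ (s + 1 - 1) = t * t ^ (s - 1) := by
    rw [mul_comm, ← Real.rpow_add_one ht.ne']; ring_nf
  rw [sub_eq_add_neg, Real.exp_add, h3]
  calc rexp (-t) * rexp (-(y ^ 2 / (4 * t))) * t ^ (s - 1)
      ≤ rexp (-t) * (y ^ 2 / (4 * t))⁻¹ * t ^ (s - 1) := by gcongr
    _ = _ := by field_simp

lemma integral_deriv_gammaBessel_integrand (s : ℝ) {y : ℝ} (hy : 0 < y) :
    ∫ t in Ioi (0 : ℝ), rexp (-t - y ^ 2 / (4 * t)) * (-(y / (2 * t))) * t ^ (s - 1)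
      = -((y / 2) ^ (2 * s - 1) * gammaBessel (1 - s) y) := by
  set a : ℝ := (y / 2) ^ 2 with ha
  have ha0 : 0 < a := by positivity
  set g : ℝ → ℝ := fun t => rexp (-t - y ^ 2 / (4 * t)) * (-(y / (2 * t))) * t ^ (s - 1)
  have h1 := integral_comp_mul_left_Ioi' g 0 ha0
  rw [mul_zero, ← integral_comp_rpow_Ioi (fun x => g (a * x)) (p := -1) (by norm_num)] at h1
  rw [← h1, gammaBessel, smul_eq_mul, ← integral_const_mul, ← integral_const_mul, ← integral_neg]
  refine setIntegral_congr_fun measurableSet_Ioi fun u (hu : 0 < u) => ?_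
  simp only [g, smul_eq_mul, Real.rpow_neg_one]
  have e1 : -(a * u⁻¹) - y ^ 2 / (4 * (a * u⁻¹)) = -u - y ^ 2 / (4 * u) := by
    rw [ha]; field_simp; ring
  have e2 : (a * u⁻¹) ^ (s - 1) = (y / 2) ^ (2 * s - 1) * (y / 2)⁻¹ * (u * u ^ (-s)) := by
    rw [Real.mul_rpow ha0.le (by positivity), ha, ← Real.rpow_natCast,
      ← Real.rpow_mul (by positivity), Real.inv_rpow hu.le, ← Real.rpow_neg hu.le,
      ← Real.rpow_neg_one (y / 2), ← Real.rpow_add (by positivity),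
      show -(s - 1) = 1 + -s by ring, Real.rpow_add hu, Real.rpow_one]
    congr 2
    push_cast
    ring
  have e3 : u ^ (1 - s - 1) = u ^ (-s) := by ring_nf
  have e4 : u ^ (-1 - 1 : ℝ) = (u ^ 2)⁻¹ := by
    rw [show (-1 - 1 : ℝ) = -((2 : ℕ) : ℝ) by norm_num, Real.rpow_neg hu.le, Real.rpow_natCast]
  rw [e1, e2, e3, e4, ha]
  simp only [abs_neg, abs_one]
  field_simp

lemma hasDerivAt_gammaBessel {s y : ℝ} (hs : 0 < s) (hy : 0 < y) :
    HasDerivAt (gammaBessel s) (-((y / 2) ^ (2 * s - 1) * gammaBessel (1 - s) y)) y := by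
  rw [← integral_deriv_gammaBessel_integrand s hy]
  refine (hasDerivAt_integral_of_dominated_loc_of_deriv_le (s := Ioi (y / 2))
    (F := fun y t => rexp (-t - y ^ 2 / (4 * t)) * t ^ (s - 1))
    (F' := fun y t => rexp (-t - y ^ 2 / (4 * t)) * (-(y / (2 * t))) * t ^ (s - 1))
    (bound := fun t => 4 / y * (rexp (-t) * t ^ (s - 1)))
    (Ioi_mem_nhds (by linarith))
    (Eventually.of_forall fun x => (measurable_gammaBessel_integrand s x).aestronglyMeasurable)
    (integrableOn_gammaBessel_integrand hs y)
    (Measurable.aestronglyMeasurable (by fun_prop)) ?_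
    ((GammaIntegral_convergent hs).const_mul _) ?_).2
  · filter_upwards [ae_restrict_mem measurableSet_Ioi] with t (ht : 0 < t) x (hx : y / 2 < x)
    have hx0 : 0 < x := by linarith
    have h2 := exp_neg_le_inv (x := x ^ 2 / (4 * t)) (by positivity)
    rw [mul_neg, neg_mul, norm_neg, Real.norm_of_nonneg (by positivity), sub_eq_add_neg,
      Real.exp_add]
    calc rexp (-t) * rexp (-(x ^ 2 / (4 * t))) * (x / (2 * t)) * t ^ (s - 1)
        ≤ rexp (-t) * (x ^ 2 / (4 * t))⁻¹ * (x / (2 * t)) * t ^ (s - 1) := by gcongr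
      _ = 2 / x * (rexp (-t) * t ^ (s - 1)) := by
        field_simp
        norm_num
      _ ≤ 4 / y * (rexp (-t) * t ^ (s - 1)) := by
        gcongr ?_ * _
        rw [div_le_div_iff₀ hx0 hy]; linarith
  · filter_upwards [ae_restrict_mem measurableSet_Ioi] with t (ht : 0 < t) x _
    refine HasDerivAt.mul_const (HasDerivAt.exp ?_) _
    have := (((hasDerivAt_id x).pow 2).div_const (4 * t)).const_sub (-t)
    convert! this using 1
    simp only [id_eq, Nat.cast_ofNat, Nat.add_one_sub_one, pow_one, mul_one]
    field_simp
    norm_num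

lemma gammaBessel_eq_besselK {s y : ℝ} (hs : 0 < s) (hy : 0 < y) :
    gammaBessel s y = 2 * (y / 2) ^ s * besselK s y := by
  set g : ℝ → ℝ := fun t => rexp (-t - y ^ 2 / (4 * t)) * t ^ (s - 1)
  set k : ℝ → ℝ := fun x => rexp (-(y * cosh x)) * rexp (s * x)
  have himg : (fun x => y / 2 * rexp x) '' univ = Ioi 0 := by
    ext t
    simp only [image_univ, mem_range, mem_Ioi]
    constructor
    · rintro ⟨x, rfl⟩; positivity
    · intro ht
      refine ⟨Real.log (t / (y / 2)), ?_⟩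
      rw [Real.exp_log (by positivity)]; field_simp
  have hder : ∀ x ∈ (univ : Set ℝ),
      HasDerivWithinAt (fun x => y / 2 * rexp x) (y / 2 * rexp x) univ x :=
    fun x _ => ((Real.hasDerivAt_exp x).const_mul _).hasDerivWithinAt
  have hinj : InjOn (fun x => y / 2 * rexp x) univ := by
    intro x _ z _ h
    exact Real.exp_injective (mul_left_cancel₀ (by positivity) h)
  have hgk : ∀ x, |y / 2 * rexp x| • g (y / 2 * rexp x) = (y / 2) ^ s * k x := by
    intro x
    have e0 : -(y / 2 * rexp x) - y ^ 2 / (4 * (y / 2 * rexp x)) = -(y * cosh x) := by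
      rw [Real.cosh_eq, Real.exp_neg]
      field_simp
      ring
    have e1 : (y / 2 * rexp x) * (y / 2 * rexp x) ^ (s - 1) = (y / 2) ^ s * rexp (s * x) := by
      rw [mul_comm (y / 2 * rexp x), ← Real.rpow_add_one (by positivity), sub_add_cancel,
        Real.mul_rpow (by positivity) (by positivity), ← Real.exp_mul, mul_comm x]
    simp only [g, k, smul_eq_mul]
    rw [abs_of_pos (by positivity), e0, mul_left_comm, e1]; ring
  have hint : Integrable k := by
    have := (integrableOn_image_iff_integrableOn_abs_deriv_smul MeasurableSet.univ hder hinj g).1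
      (himg ▸ integrableOn_gammaBessel_integrand hs y)
    simp only [hgk, integrableOn_univ] at this
    have h2 := this.const_mul (((y / 2) ^ s)⁻¹)
    refine h2.congr (Eventually.of_forall fun x => ?_)
    have : (y / 2) ^ s ≠ 0 := by positivity
    field_simp
  have h1 : gammaBessel s y = (y / 2) ^ s * ∫ x, k x := by
    have := integral_image_eq_integral_abs_deriv_smul MeasurableSet.univ hder hinj g
    rw [himg] at this
    simp only [hgk, integral_const_mul, setIntegral_univ] at this
    exact this
  have h2 : ∫ x, k x = 2 * besselK s y := by
    rw [← setIntegral_univ, ← Iic_union_Ioi (a := (0 : ℝ)),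
      setIntegral_union (Iic_disjoint_Ioi le_rfl) measurableSet_Ioi hint.integrableOn
        hint.integrableOn]
    have := integral_comp_neg_Ioi (0 : ℝ) k
    rw [neg_zero] at this
    rw [← this, ← integral_add hint.comp_neg.integrableOn hint.integrableOn, besselK,
      ← integral_const_mul]
    congr 1
    ext x
    simp only [k, Real.cosh_neg, Real.cosh_eq (s * x)]
    ring_nf
  rw [h1, h2]; ring

lemma psi_eq_gammaBessel {s : ℝ} (hs : 0 < s) : psi s = fun y => gammaBessel s y / Gamma s := by
  ext y
  have hG := (Gamma_pos_of_pos hs).ne'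
  by_cases hy : y = 0
  · simp [psi, hy, gammaBessel_zero hs, hG]
  · have habs : gammaBessel s y = gammaBessel s |y| := by simp [gammaBessel]
    have hy' : 0 < |y| := abs_pos.2 hy
    rw [psi, if_neg hy, habs, gammaBessel_eq_besselK hs hy', Real.div_rpow hy'.le (by norm_num),
      Real.rpow_sub (by norm_num), Real.rpow_one]
    field_simp

lemma AbsolutelyContinuousOnInterval.of_eqOn {f g : ℝ → ℝ} {a b : ℝ}
    (hf : AbsolutelyContinuousOnInterval f a b) (hfg : EqOn f g (uIcc a b)) :
    AbsolutelyContinuousOnInterval g a b := by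
  refine Tendsto.congr' ?_ hf
  filter_upwards [mem_inf_of_right (mem_principal_self _)] with E hE
  refine Finset.sum_congr rfl fun i hi => ?_
  rw [hfg (hE.1 i hi).1, hfg (hE.1 i hi).2]

lemma AbsolutelyContinuousOnInterval.of_eq_add_integral {f g : ℝ → ℝ} {a b : ℝ}
    (hg : IntervalIntegrable g volume a b)
    (hf : ∀ y ∈ uIcc a b, f y = f a + ∫ t in a..y, g t) :
    AbsolutelyContinuousOnInterval f a b := by
  have h1 := hg.absolutelyContinuousOnInterval_intervalIntegral (left_mem_uIcc)
  have h2 : AbsolutelyContinuousOnInterval (fun _ : ℝ => f a) a b := by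
    simp [AbsolutelyContinuousOnInterval, tendsto_const_nhds]
  exact (h2.add h1).of_eqOn fun y hy => (hf y hy).symm

/-- Green identity on the half-line for the operator sending φ to the derivative of the flux
`W y = y^b * deriv φ y`, tested against an
absolutely continuous `ψ` of finite energy. -/
lemma integral_weighted_energy_eq {b : ℝ} {φ W ψ : ℝ → ℝ}
    (hW : ∀ y, 0 < y → W y = y ^ b * deriv φ y)
    (hW' : ∀ y, 0 < y → deriv W y = y ^ b * φ y)
    (hWac : ∀ R, 0 < R → AbsolutelyContinuousOnInterval W 0 R)
    (hφ : Measurable φ)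
    (hφi : IntegrableOn (fun y => y ^ b * (deriv φ y ^ 2 + φ y ^ 2)) (Ioi 0))
    (hψac : ∀ R, 0 < R → AbsolutelyContinuousOnInterval ψ 0 R)
    (hψ : AEStronglyMeasurable ψ (volume.restrict (Ioi 0)))
    (hψi : IntegrableOn (fun y => y ^ b * (deriv ψ y ^ 2 + ψ y ^ 2)) (Ioi 0)) :
    IntegrableOn (fun y => y ^ b * (deriv ψ y * deriv φ y + ψ y * φ y)) (Ioi 0) ∧
      ∫ y in Ioi 0, y ^ b * (deriv ψ y * deriv φ y + ψ y * φ y) = -(ψ 0 * W 0) := by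
  have hwm : Measurable fun y : ℝ => y ^ b := by fun_prop
  have hint : IntegrableOn (fun y => y ^ b * (deriv ψ y * deriv φ y + ψ y * φ y)) (Ioi 0) := by
    refine (hφi.add hψi).mono' (hwm.aestronglyMeasurable.mul
      (((measurable_deriv ψ).mul (measurable_deriv φ)).aestronglyMeasurable.add
        (hψ.mul hφ.aestronglyMeasurable))) ?_
    filter_upwards [ae_restrict_mem measurableSet_Ioi] with y (hy : 0 < y)
    rw [norm_mul, Real.norm_of_nonneg (by positivity : 0 ≤ y ^ b), Pi.add_apply, ← mul_add]
    gcongr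
    rw [Real.norm_eq_abs, abs_le]
    constructor <;> nlinarith [sq_nonneg (deriv ψ y + deriv φ y), sq_nonneg (ψ y + φ y),
      sq_nonneg (deriv ψ y - deriv φ y), sq_nonneg (ψ y - φ y), sq_nonneg (deriv ψ y),
      sq_nonneg (deriv φ y), sq_nonneg (ψ y), sq_nonneg (φ y)]
  refine ⟨hint, ?_⟩
  have hparts : ∀ R, 0 < R →
      ∫ y in (0 : ℝ)..R, y ^ b * (deriv ψ y * deriv φ y + ψ y * φ y)
        = ψ R * W R - ψ 0 * W 0 := by
    intro R hR
    rw [← (hψac R hR).integral_deriv_mul_eq_sub (hWac R hR)]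
    refine intervalIntegral.integral_congr_ae (Eventually.of_forall fun y hy => ?_)
    rw [uIoc_of_le hR.le] at hy
    rw [hW y hy.1, hW' y hy.1]
    ring
  have hlim := intervalIntegral_tendsto_integral_Ioi 0 hint tendsto_id
  have hlim2 : Tendsto (fun R => ψ R * W R) atTop
      (nhds ((∫ y in Ioi 0, y ^ b * (deriv ψ y * deriv φ y + ψ y * φ y)) + ψ 0 * W 0)) := by
    refine (hlim.add_const (ψ 0 * W 0)).congr' ?_
    filter_upwards [eventually_gt_atTop 0] with R hR
    simp only [id, hparts R hR, sub_add_cancel]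
  have hint2 : IntegrableOn (fun R => ψ R * W R) (Ioi 0) := by
    have : IntegrableOn (fun y => ψ y * (y ^ b * deriv φ y)) (Ioi 0) := by
      refine (hφi.add hψi).mono' (hψ.mul
        (hwm.mul (measurable_deriv φ)).aestronglyMeasurable) ?_
      filter_upwards [ae_restrict_mem measurableSet_Ioi] with y (hy : 0 < y)
      rw [mul_left_comm, norm_mul, Real.norm_of_nonneg (by positivity : 0 ≤ y ^ b), Pi.add_apply,
        ← mul_add]
      gcongr
      rw [Real.norm_eq_abs, abs_le]
      constructor <;> nlinarith [sq_nonneg (ψ y + deriv φ y), sq_nonneg (ψ y - deriv φ y),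
        sq_nonneg (deriv ψ y), sq_nonneg (deriv φ y), sq_nonneg (ψ y), sq_nonneg (φ y)]
    exact this.congr_fun (fun y hy => by simp only [hW y hy]) measurableSet_Ioi
  have hzero := IntegrableAtFilter.eq_zero_of_tendsto (μ := volume)
    ⟨Ioi 0, Ioi_mem_atTop 0, hint2⟩ (fun s hs => by
      obtain ⟨c, hc⟩ := mem_atTop_sets.1 hs
      rw [← top_le_iff, ← volume_Ici (a := c)]
      exact measure_mono hc) hlim2
  linarith

lemma absolutelyContinuousOnInterval_gammaBessel {s : ℝ} (hs : 0 < s) (hs1 : s < 1) {R : ℝ}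
    (hR : 0 < R) : AbsolutelyContinuousOnInterval (gammaBessel s) 0 R := by
  have hr : -1 < 2 * s - 1 := by linarith
  have hg : IntervalIntegrable (fun y => -((y / 2) ^ (2 * s - 1) * gammaBessel (1 - s) y))
      volume 0 R := by
    have h1 : IntervalIntegrable (fun y : ℝ => (1 / 2 : ℝ) ^ (2 * s - 1) * y ^ (2 * s - 1))
        volume 0 R := (intervalIntegral.intervalIntegrable_rpow' hr).const_mul _
    have h2 := (h1.mul_continuousOn
      (continuous_gammaBessel (s := 1 - s) (by linarith)).continuousOn).neg
    refine h2.congr fun y hy => ?_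
    rw [uIoc_of_le hR.le] at hy
    have := hy.1.le
    simp only [Pi.neg_apply]
    rw [← Real.mul_rpow (by norm_num) this]
    ring_nf
  refine .of_eq_add_integral hg fun y hy => ?_
  rw [uIcc_of_le hR.le] at hy
  rw [intervalIntegral.integral_eq_sub_of_hasDerivAt_of_le hy.1
    (continuous_gammaBessel hs).continuousOn (fun x hx => hasDerivAt_gammaBessel hs hx.1)
    (hg.mono_set (by rw [uIcc_of_le hy.1, uIcc_of_le hR.le]; exact Icc_subset_Icc_right hy.2))]
  ring

lemma integrableOn_rpow_mul_gammaBessel_sq {s : ℝ} (hs : 0 < s) (hs1 : s < 1) :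
    IntegrableOn (fun y => y ^ (1 - 2 * s) * gammaBessel s y ^ 2) (Ioi 0) := by
  have hmeas : Measurable fun y : ℝ => y ^ (1 - 2 * s) * gammaBessel s y ^ 2 :=
    (by fun_prop : Measurable fun y : ℝ => y ^ (1 - 2 * s)).mul
      ((continuous_gammaBessel hs).measurable.pow_const 2)
  rw [← Ioc_union_Ioi_eq_Ioi (zero_le_one (α := ℝ)), integrableOn_union]
  constructor
  · have h1 : IntegrableOn (fun y : ℝ => y ^ (1 - 2 * s)) (Ioc 0 1) :=
      (intervalIntegrable_iff_integrableOn_Ioc_of_le zero_le_one).1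
        (intervalIntegral.intervalIntegrable_rpow' (by linarith))
    refine (h1.mul_const (Gamma s ^ 2)).mono' hmeas.aestronglyMeasurable ?_
    filter_upwards [ae_restrict_mem measurableSet_Ioc] with y hy
    have := hy.1
    rw [Real.norm_of_nonneg (by positivity)]
    gcongr
    · exact gammaBessel_nonneg s y
    · exact gammaBessel_le_Gamma hs y
  · have h1 : IntegrableOn (fun y : ℝ => y ^ (-3 - 2 * s)) (Ioi 1) :=
      integrableOn_Ioi_rpow_of_lt (by linarith) one_pos
    refine (h1.mul_const ((4 * Gamma (s + 1)) ^ 2)).mono' hmeas.aestronglyMeasurable ?_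
    filter_upwards [ae_restrict_mem measurableSet_Ioi] with y (hy : 1 < y)
    have hy0 : 0 < y := by linarith
    rw [Real.norm_of_nonneg (by positivity)]
    have e : y ^ (1 - 2 * s) = y ^ (-3 - 2 * s) * y ^ 4 := by
      rw [← Real.rpow_natCast, ← Real.rpow_add hy0]
      congr 1
      push_cast
      ring
    calc y ^ (1 - 2 * s) * gammaBessel s y ^ 2
        ≤ y ^ (1 - 2 * s) * (4 * Gamma (s + 1) / y ^ 2) ^ 2 := by
          gcongr
          · exact gammaBessel_nonneg s y
          · exact gammaBessel_le_div_sq hs hy0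
      _ = _ := by rw [e]; field_simp

lemma psi_zero (s : ℝ) : psi s 0 = 1 := if_pos rfl

lemma psi_neg (s y : ℝ) : psi s (-y) = psi s y := by simp [psi]

lemma continuous_psi {s : ℝ} (hs : 0 < s) : Continuous (psi s) := by
  rw [psi_eq_gammaBessel hs]
  exact (continuous_gammaBessel hs).div_const _

lemma absolutelyContinuousOnInterval_psi {s : ℝ} (hs : 0 < s) (hs1 : s < 1) {R : ℝ} (hR : 0 < R) :
    AbsolutelyContinuousOnInterval (psi s) 0 R := by
  rw [psi_eq_gammaBessel hs]
  simpa only [div_eq_inv_mul] using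
    (absolutelyContinuousOnInterval_gammaBessel hs hs1 hR).const_mul (Gamma s)⁻¹

/-- The flux `y^{1−2s} * deriv (psi s) y`, extended continuously to `y = 0`. -/
noncomputable def psiFlux (s y : ℝ) : ℝ :=
  -(2 ^ (1 - 2 * s) / Gamma s) * gammaBessel (1 - s) y

lemma psiFlux_zero {s : ℝ} (hs1 : s < 1) :
    psiFlux s 0 = -(2 ^ (1 - 2 * s) * Gamma (1 - s) / Gamma s) := by
  rw [psiFlux, gammaBessel_zero (by linarith)]
  ring

lemma psiFlux_eq {s y : ℝ} (hs : 0 < s) (hy : 0 < y) :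
    psiFlux s y = y ^ (1 - 2 * s) * deriv (psi s) y := by
  rw [psi_eq_gammaBessel hs, ((hasDerivAt_gammaBessel hs hy).div_const _).deriv, psiFlux,
    Real.div_rpow hy.le (by norm_num), show 2 * s - 1 = -(1 - 2 * s) by ring,
    Real.rpow_neg hy.le, Real.rpow_neg (by norm_num)]
  field_simp

lemma deriv_psiFlux {s y : ℝ} (hs : 0 < s) (hs1 : s < 1) (hy : 0 < y) :
    deriv (psiFlux s) y = y ^ (1 - 2 * s) * psi s y := by
  have h : HasDerivAt (psiFlux s) _ y :=
    (hasDerivAt_gammaBessel (s := 1 - s) (by linarith) hy).const_mul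
      (-(2 ^ (1 - 2 * s) / Gamma s))
  rw [h.deriv, psi_eq_gammaBessel hs, sub_sub_cancel, show 2 * (1 - s) - 1 = 1 - 2 * s by ring,
    Real.div_rpow hy.le (by norm_num)]
  field_simp

lemma integrableOn_energy_psi {s : ℝ} (hs : 0 < s) (hs1 : s < 1) :
    IntegrableOn (fun y => y ^ (1 - 2 * s) * (deriv (psi s) y ^ 2 + psi s y ^ 2)) (Ioi 0) := by
  have h1 := (integrableOn_rpow_mul_gammaBessel_sq hs hs1).const_mul ((Gamma s ^ 2)⁻¹)
  have h2 := (integrableOn_rpow_mul_gammaBessel_sq (s := 1 - s) (by linarith)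
    (by linarith)).const_mul ((2 ^ (1 - 2 * s) / Gamma s) ^ 2)
  refine IntegrableOn.congr_fun (h2.add h1) (fun y (hy : 0 < y) => ?_) measurableSet_Ioi
  have hd : deriv (psi s) y = psiFlux s y / y ^ (1 - 2 * s) := by
    rw [psiFlux_eq hs hy]
    have : y ^ (1 - 2 * s) ≠ 0 := by positivity
    field_simp
  simp only [Pi.add_apply]
  rw [hd, psi_eq_gammaBessel hs, psiFlux, show 1 - 2 * (1 - s) = -(1 - 2 * s) by ring,
    Real.rpow_neg hy.le]
  field_simp

lemma integral_energy_psi_mul {s : ℝ} (hs : 0 < s) (hs1 : s < 1) {ψ : ℝ → ℝ}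
    (hψac : ∀ R, 0 < R → AbsolutelyContinuousOnInterval ψ 0 R)
    (hψ : AEStronglyMeasurable ψ (volume.restrict (Ioi 0)))
    (hψi : IntegrableOn (fun y => y ^ (1 - 2 * s) * (deriv ψ y ^ 2 + ψ y ^ 2)) (Ioi 0)) :
    IntegrableOn (fun y => y ^ (1 - 2 * s) * (deriv ψ y * deriv (psi s) y + ψ y * psi s y))
        (Ioi 0) ∧
      ∫ y in Ioi 0, y ^ (1 - 2 * s) * (deriv ψ y * deriv (psi s) y + ψ y * psi s y)
        = 2 ^ (1 - 2 * s) * Gamma (1 - s) / Gamma s * ψ 0 := by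
  have h := integral_weighted_energy_eq (fun y hy => psiFlux_eq hs hy)
    (fun y hy => deriv_psiFlux hs hs1 hy)
    (fun R hR => (absolutelyContinuousOnInterval_gammaBessel (s := 1 - s) (by linarith)
      (by linarith) hR).const_mul _)
    (continuous_psi hs).measurable (integrableOn_energy_psi hs hs1) hψac hψ hψi
  refine ⟨h.1, ?_⟩
  rw [h.2, psiFlux_zero hs1]
  ring

lemma integral_Ioi_energy_psi {s : ℝ} (hs : 0 < s) (hs1 : s < 1) :
    ∫ y in Ioi 0, y ^ (1 - 2 * s) * (deriv (psi s) y ^ 2 + psi s y ^ 2)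
      = 2 ^ (1 - 2 * s) * Gamma (1 - s) / Gamma s := by
  have h := (integral_energy_psi_mul hs hs1
    (fun R hR => absolutelyContinuousOnInterval_psi hs hs1 hR)
    (continuous_psi hs).aestronglyMeasurable (integrableOn_energy_psi hs hs1)).2
  rw [psi_zero, mul_one] at h
  simpa only [sq] using h

lemma le_integral_Ioi_energy {s : ℝ} (hs : 0 < s) (hs1 : s < 1) {ψ : ℝ → ℝ}
    (hψac : ∀ R, 0 < R → AbsolutelyContinuousOnInterval ψ 0 R)
    (hψ : AEStronglyMeasurable ψ (volume.restrict (Ioi 0)))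
    (hψi : IntegrableOn (fun y => y ^ (1 - 2 * s) * (deriv ψ y ^ 2 + ψ y ^ 2)) (Ioi 0)) :
    2 ^ (1 - 2 * s) * Gamma (1 - s) / Gamma s * ψ 0 ^ 2
      ≤ ∫ y in Ioi 0, y ^ (1 - 2 * s) * (deriv ψ y ^ 2 + ψ y ^ 2) := by
  obtain ⟨hi, he⟩ := integral_energy_psi_mul hs hs1 hψac hψ hψi
  have hp := integrableOn_energy_psi hs hs1
  have key : 0 ≤ ∫ y in Ioi 0, (y ^ (1 - 2 * s) * (deriv ψ y ^ 2 + ψ y ^ 2)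
      - 2 * ψ 0 * (y ^ (1 - 2 * s) * (deriv ψ y * deriv (psi s) y + ψ y * psi s y))
      + ψ 0 ^ 2 * (y ^ (1 - 2 * s) * (deriv (psi s) y ^ 2 + psi s y ^ 2))) := by
    refine setIntegral_nonneg measurableSet_Ioi fun y (hy : 0 < y) => ?_
    have : 0 ≤ y ^ (1 - 2 * s) *
        ((deriv ψ y - ψ 0 * deriv (psi s) y) ^ 2 + (ψ y - ψ 0 * psi s y) ^ 2) := by positivity
    linarith
  have hi' := hi.const_mul (2 * ψ 0)
  have hsub : IntegrableOn (fun y => y ^ (1 - 2 * s) * (deriv ψ y ^ 2 + ψ y ^ 2)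
      - 2 * ψ 0 * (y ^ (1 - 2 * s) * (deriv ψ y * deriv (psi s) y + ψ y * psi s y))) (Ioi 0) :=
    hψi.sub hi'
  rw [integral_add hsub (hp.const_mul _), integral_sub hψi hi', integral_const_mul,
    integral_const_mul, he, integral_Ioi_energy_psi hs hs1] at key
  linarith

lemma intervalIntegrable_of_weighted_sq {b : ℝ} (hb : b < 1) {g : ℝ → ℝ} (hgm : Measurable g)
    (hg : IntegrableOn (fun y => y ^ b * g y ^ 2) (Ioi 0)) {R : ℝ} (hR : 0 < R) :
    IntervalIntegrable g volume 0 R := by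
  rw [intervalIntegrable_iff_integrableOn_Ioc_of_le hR.le]
  have h1 : IntegrableOn (fun y : ℝ => y ^ (-b)) (Ioc 0 R) :=
    (intervalIntegrable_iff_integrableOn_Ioc_of_le hR.le).1
      (intervalIntegral.intervalIntegrable_rpow' (by linarith))
  refine (h1.add (hg.mono_set Ioc_subset_Ioi_self)).mono' hgm.aestronglyMeasurable ?_
  filter_upwards [ae_restrict_mem measurableSet_Ioc] with y hy
  have hyb : 0 < y ^ b := Real.rpow_pos_of_pos hy.1 b
  rw [Pi.add_apply, Real.rpow_neg hy.1.le, Real.norm_eq_abs, ← sq_abs (g y),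
    ← mul_le_mul_iff_right₀ hyb, mul_add, mul_inv_cancel₀ hyb.ne']
  nlinarith [sq_nonneg (y ^ b * |g y| - 1), mul_nonneg hyb.le (abs_nonneg (g y))]

lemma le_integral_Ioi_energy_of_eq_add_integral {s : ℝ} (hs : 0 < s) (hs1 : s < 1) {ψ : ℝ → ℝ}
    (hψ : ∀ y, ψ y = ψ 0 + ∫ t in (0 : ℝ)..y, deriv ψ t)
    (hψi : IntegrableOn (fun y => y ^ (1 - 2 * s) * (deriv ψ y ^ 2 + ψ y ^ 2)) (Ioi 0)) :
    2 ^ (1 - 2 * s) * Gamma (1 - s) / Gamma s * ψ 0 ^ 2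
      ≤ ∫ y in Ioi 0, y ^ (1 - 2 * s) * (deriv ψ y ^ 2 + ψ y ^ 2) := by
  have hd : IntegrableOn (fun y => y ^ (1 - 2 * s) * deriv ψ y ^ 2) (Ioi 0) := by
    refine hψi.mono' (Measurable.aestronglyMeasurable
      ((by fun_prop : Measurable fun y : ℝ => y ^ (1 - 2 * s)).mul
        ((measurable_deriv ψ).pow_const 2))) ?_
    filter_upwards [ae_restrict_mem measurableSet_Ioi] with y (hy : 0 < y)
    rw [Real.norm_of_nonneg (by positivity)]
    gcongr
    linarith [sq_nonneg (ψ y)]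
  have hac : ∀ R, 0 < R → AbsolutelyContinuousOnInterval ψ 0 R := fun R hR =>
    .of_eq_add_integral (intervalIntegrable_of_weighted_sq (by linarith) (measurable_deriv ψ) hd hR)
      fun y _ => hψ y
  refine le_integral_Ioi_energy hs hs1 hac (ContinuousOn.aestronglyMeasurable
    (fun y (hy : 0 < y) => ContinuousAt.continuousWithinAt ?_) measurableSet_Ioi) hψi
  refine (hac (y + 1) (by linarith)).continuousOn.continuousAt ?_
  rw [uIcc_of_le (by linarith)]
  exact Icc_mem_nhds hy (by linarith)

lemma integral_energy_psi {s : ℝ} (hs : 0 < s) (hs1 : s < 1) :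
    ∫ y : ℝ, |y| ^ (1 - 2 * s) * (deriv (psi s) y ^ 2 + psi s y ^ 2)
      = 2 * (2 ^ (1 - 2 * s) * Gamma (1 - s) / Gamma s) := by
  rw [← integral_Ioi_energy_psi hs hs1, ← integral_comp_abs]
  congr 1
  ext y
  rcases le_total 0 y with hy | hy
  · rw [abs_of_nonneg hy]
  · have h := deriv_comp_neg (psi s) y
    simp only [psi_neg] at h
    rw [abs_of_nonpos hy, psi_neg, h, neg_sq]

lemma le_integral_energy {s : ℝ} (hs : 0 < s) (hs1 : s < 1) {ψ : ℝ → ℝ}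
    (hψ : ∀ y, ψ y = ψ 0 + ∫ t in (0 : ℝ)..y, deriv ψ t)
    (hψi : Integrable fun y => |y| ^ (1 - 2 * s) * (deriv ψ y ^ 2 + ψ y ^ 2)) :
    2 * (2 ^ (1 - 2 * s) * Gamma (1 - s) / Gamma s) * ψ 0 ^ 2
      ≤ ∫ y : ℝ, |y| ^ (1 - 2 * s) * (deriv ψ y ^ 2 + ψ y ^ 2) := by
  have half : ∀ χ : ℝ → ℝ, (∀ y, χ y = χ 0 + ∫ t in (0 : ℝ)..y, deriv χ t) →
      Integrable (fun y => |y| ^ (1 - 2 * s) * (deriv χ y ^ 2 + χ y ^ 2)) →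
      2 ^ (1 - 2 * s) * Gamma (1 - s) / Gamma s * χ 0 ^ 2
        ≤ ∫ y in Ioi 0, |y| ^ (1 - 2 * s) * (deriv χ y ^ 2 + χ y ^ 2) := by
    intro χ hχ hχi
    have e : EqOn (fun y => |y| ^ (1 - 2 * s) * (deriv χ y ^ 2 + χ y ^ 2))
        (fun y => y ^ (1 - 2 * s) * (deriv χ y ^ 2 + χ y ^ 2)) (Ioi 0) := fun y (hy : 0 < y) => by
      simp only [abs_of_pos hy]
    rw [setIntegral_congr_fun measurableSet_Ioi e]
    exact le_integral_Ioi_energy_of_eq_add_integral hs hs1 hχ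
      (hχi.integrableOn.congr_fun e measurableSet_Ioi)
  have hneg : ∀ y, deriv (fun x => ψ (-x)) y = -deriv ψ (-y) := fun y => deriv_comp_neg ψ y
  have e : (fun y => |y| ^ (1 - 2 * s) * (deriv (fun x => ψ (-x)) y ^ 2 + ψ (-y) ^ 2))
      = fun y => (fun x => |x| ^ (1 - 2 * s) * (deriv ψ x ^ 2 + ψ x ^ 2)) (-y) := by
    ext y
    simp only [hneg, neg_sq, abs_neg]
  have h1 := half ψ hψ hψi
  have h2 := half (fun x => ψ (-x)) (fun y => by
    simp only [hneg, neg_zero, intervalIntegral.integral_neg]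
    rw [intervalIntegral.integral_comp_neg (deriv ψ), intervalIntegral.integral_symm, neg_zero,
      neg_neg]
    exact hψ (-y)) (e ▸ hψi.comp_neg)
  rw [e, integral_comp_neg_Ioi 0 fun x => |x| ^ (1 - 2 * s) * (deriv ψ x ^ 2 + ψ x ^ 2),
    neg_zero] at h2
  rw [← setIntegral_univ, ← Iic_union_Ioi (a := (0 : ℝ)),
    setIntegral_union (Iic_disjoint_Ioi le_rfl) measurableSet_Ioi hψi.integrableOn
      hψi.integrableOn]
  linarith

/-- for `b ∈ (−1,1)` and `m_b = 2^{1+b}·Γ((1+b)/2)/Γ((1−b)/2)`,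
the trace inequality `m_b·ψ(0)² ≤ ∫ |y|^b·(ψ'(y)² + ψ(y)²) dy` holds for all admissible
`ψ`, with equality for `ψ = ψ_{(1−b)/2}`; thus `m_b` is the sharp constant. -/
theorem trace_inequality_sharp (b : ℝ) (hb0 : -1 < b) (hb1 : b < 1)
    (m : ℝ) (hm : m = (2 : ℝ) ^ (1 + b) * Real.Gamma ((1 + b) / 2)
                    / Real.Gamma ((1 - b) / 2)) :
    (∀ ψ : ℝ → ℝ,
      (∀ᵐ y : ℝ ∂volume, DifferentiableAt ℝ ψ y) →
      (∀ y : ℝ, ψ y = ψ 0 + ∫ t in (0 : ℝ)..y, deriv ψ t) →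
      Integrable (fun y : ℝ => |y| ^ b * ((deriv ψ y) ^ 2 + (ψ y) ^ 2)) →
      m * (ψ 0) ^ 2 ≤ ∫ y : ℝ, |y| ^ b * ((deriv ψ y) ^ 2 + (ψ y) ^ 2)) ∧
    m * (psi ((1 - b) / 2) 0) ^ 2
      = ∫ y : ℝ, |y| ^ b *
          ((deriv (psi ((1 - b) / 2)) y) ^ 2 + (psi ((1 - b) / 2) y) ^ 2) := by
  obtain ⟨s, rfl⟩ : ∃ s, b = 1 - 2 * s := ⟨(1 - b) / 2, by ring⟩
  have hs : 0 < s := by linarith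
  have hs1 : s < 1 := by linarith
  have hm' : m = 2 * (2 ^ (1 - 2 * s) * Gamma (1 - s) / Gamma s) := by
    rw [hm, Real.rpow_add (by norm_num), Real.rpow_one,
      show (1 + (1 - 2 * s)) / 2 = 1 - s by ring, show (1 - (1 - 2 * s)) / 2 = s by ring]
    ring
  refine ⟨fun ψ _ hψ hψi => hm' ▸ le_integral_energy hs hs1 hψ hψi, ?_⟩
  rw [show (1 - (1 - 2 * s)) / 2 = s by ring, integral_energy_psi hs hs1, psi_zero, hm']
  ring
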